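/- Assume the decomposition hypotheses for the frame (ξ1, ξ2) along x, including the frame condition that ∂ξ_k/∂u_i has no ξ2-component, and let u0 ∈ U be such that the matrix (h2_{ij}(u0)) is invertible. Then the following are equivalent: (a) there exists p ∈ ℝ⁴ such that u0 is a critical point of the affine distance function s_p (where x(u) − p = dx(u)(Z(u)) + δ(u)ξ1(u) + s_p(u)ξ2(u)) and the full Hessian matrix of s_p at u0 is zero (a singularity of corank 2); (b) there exist (a,b) ∈ ℝ² \ {(0,0)} and μ ≠ 0 such that a·S1(u0) + b·S2(u0) = μ·Id, i.e. u0 is an affine semiumbilic point: the shape operator of some nonzero vector ν = a ξ1(u0) + b ξ2(u0) in the transversal plane is a nonzero multiple of the identity. -/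

import Mathlib

open Matrix

/-- The partial derivative of `f` in the `i`-th coordinate direction at `u`. -/
noncomputable def pder {E : Type*} [NormedAddCommGroup E] [NormedSpace ℝ E]
    (f : (Fin 2 → ℝ) → E) (i : Fin 2) (u : Fin 2 → ℝ) : E :=
  fderiv ℝ f u (Pi.single i 1)

section PartialDerivatives

variable {E : Type*} [NormedAddCommGroup E] [NormedSpace ℝ E]

theorem fderiv_apply_eq_pder (f : (Fin 2 → ℝ) → E) (u v : Fin 2 → ℝ) :
    fderiv ℝ f u v = v 0 • pder f 0 u + v 1 • pder f 1 u := by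
  have h : v = v 0 • (Pi.single 0 1 : Fin 2 → ℝ) + v 1 • (Pi.single 1 1 : Fin 2 → ℝ) := by
    ext k
    fin_cases k <;> simp
  conv_lhs => rw [h]
  simp only [map_add, map_smul, pder]

theorem pder_congr {f g : (Fin 2 → ℝ) → E} {U : Set (Fin 2 → ℝ)} (hU : IsOpen U)
    (h : ∀ u ∈ U, f u = g u) (i : Fin 2) {u : Fin 2 → ℝ} (hu : u ∈ U) :
    pder f i u = pder g i u := by
  have : f =ᶠ[nhds u] g := by
    filter_upwards [hU.mem_nhds hu] with v hv using h v hv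
  rw [pder, pder, this.fderiv_eq]

theorem pder_add {f g : (Fin 2 → ℝ) → E} {u : Fin 2 → ℝ} (i : Fin 2)
    (hf : DifferentiableAt ℝ f u) (hg : DifferentiableAt ℝ g u) :
    pder (fun v => f v + g v) i u = pder f i u + pder g i u := by
  simp only [pder]
  rw [fderiv_fun_add hf hg]
  rfl

theorem pder_smul {c : (Fin 2 → ℝ) → ℝ} {f : (Fin 2 → ℝ) → E} {u : Fin 2 → ℝ} (i : Fin 2)
    (hc : DifferentiableAt ℝ c u) (hf : DifferentiableAt ℝ f u) :
    pder (fun v => c v • f v) i u = c u • pder f i u + pder c i u • f u := by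
  simp only [pder]
  rw [fderiv_fun_smul hc hf]
  rfl

theorem ContDiffOn.pder {f : (Fin 2 → ℝ) → E} {U : Set (Fin 2 → ℝ)} (hU : IsOpen U)
    (hf : ContDiffOn ℝ (⊤ : ℕ∞) f U) (i : Fin 2) :
    ContDiffOn ℝ (⊤ : ℕ∞) (_root_.pder f i) U :=
  (hf.fderiv_of_isOpen hU (by exact_mod_cast le_rfl)).clm_apply contDiffOn_const

end PartialDerivatives

theorem ContDiffOn.matrix_det {E n : Type*} [NormedAddCommGroup E] [NormedSpace ℝ E]
    [Fintype n] [DecidableEq n] {k : WithTop ℕ∞} {s : Set E} {A : E → Matrix n n ℝ}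
    (hA : ∀ i j, ContDiffOn ℝ k (fun u => A u i j) s) :
    ContDiffOn ℝ k (fun u => (A u).det) s := by
  simp only [Matrix.det_apply, Units.smul_def, zsmul_eq_mul]
  exact ContDiffOn.sum fun σ _ => contDiffOn_const.mul (contDiffOn_prod fun i _ => hA _ _)

/-- The coordinates of a smooth vector field in a smooth frame are smooth. -/
theorem exists_contDiffOn_frame_coordinates {E n : Type*} [NormedAddCommGroup E]
    [NormedSpace ℝ E] [Fintype n] [DecidableEq n] {k : WithTop ℕ∞} {s : Set E}
    {F : E → n → n → ℝ} {y : E → n → ℝ} (hF : ∀ i, ContDiffOn ℝ k (fun u => F u i) s)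
    (hy : ContDiffOn ℝ k y s) (hind : ∀ u ∈ s, LinearIndependent ℝ (F u)) :
    ∃ c : n → E → ℝ, (∀ i, ContDiffOn ℝ k (c i) s) ∧
      ∀ u ∈ s, y u = ∑ i, c i u • F u i := by
  have hdet : ∀ u ∈ s, (Matrix.of (F u)).det ≠ 0 := fun u hu =>
    ((Matrix.isUnit_iff_isUnit_det _).1
      (Matrix.linearIndependent_rows_iff_isUnit.1 (hind u hu))).ne_zero
  have hFe : ∀ i j, ContDiffOn ℝ k (fun u => F u i j) s := fun i =>
    contDiffOn_pi.1 (hF i)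
  refine ⟨fun i u => Matrix.cramer (Matrix.of (F u))ᵀ (y u) i / (Matrix.of (F u)).det,
    fun i => ?_, fun u hu => ?_⟩
  · refine ContDiffOn.div ?_ (ContDiffOn.matrix_det hFe) hdet
    simp only [Matrix.cramer_apply]
    refine ContDiffOn.matrix_det fun a b => ?_
    by_cases hb : b = i
    · subst hb
      simpa using contDiffOn_pi.1 hy a
    · simpa [Matrix.updateCol_apply, hb] using hFe b a
  · have h := Matrix.mulVec_cramer (Matrix.of (F u))ᵀ (y u)
    rw [Matrix.det_transpose] at h
    ext j
    have hj := congrFun h j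
    simp only [Matrix.mulVec, dotProduct, Matrix.transpose_apply, Matrix.of_apply,
      Pi.smul_apply, smul_eq_mul] at hj
    simp only [Finset.sum_apply, Pi.smul_apply, smul_eq_mul, div_mul_eq_mul_div]
    rw [← Finset.sum_div, eq_div_iff (hdet u hu), mul_comm, ← hj]
    exact Finset.sum_congr rfl fun i _ => mul_comm _ _

theorem LinearIndependent.eq_of_fin_four_combination {V : Type*} [AddCommGroup V]
    [Module ℝ V] {v₀ v₁ v₂ v₃ : V} (h : LinearIndependent ℝ ![v₀, v₁, v₂, v₃])
    {a b c d a' b' c' d' : ℝ}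
    (heq : a • v₀ + b • v₁ + c • v₂ + d • v₃ = a' • v₀ + b' • v₁ + c' • v₂ + d' • v₃) :
    a = a' ∧ b = b' ∧ c = c' ∧ d = d' := by
  have hz := Fintype.linearIndependent_iff.1 h ![a - a', b - b', c - c', d - d'] (by
    simp only [Fin.sum_univ_four]
    simp only [Matrix.cons_val]
    rw [← sub_eq_zero] at heq
    rw [← heq]
    module)
  exact ⟨by simpa [sub_eq_zero] using hz 0, by simpa [sub_eq_zero] using hz 1,
    by simpa [sub_eq_zero] using hz 2, by simpa [sub_eq_zero] using hz 3⟩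

/-- The structure equations of the position vector relative to a moving frame whose
normal vectors have derivatives without `ξ2`-component. -/
theorem position_structure_equations {U : Set (Fin 2 → ℝ)} (hU : IsOpen U)
    {x ξ1 ξ2 : (Fin 2 → ℝ) → (Fin 4 → ℝ)}
    (hx : ContDiffOn ℝ (⊤ : ℕ∞) x U) (hξ1 : ContDiffOn ℝ (⊤ : ℕ∞) ξ1 U)
    (hξ2 : ContDiffOn ℝ (⊤ : ℕ∞) ξ2 U)
    (hind : ∀ u ∈ U, LinearIndependent ℝ ![pder x 0 u, pder x 1 u, ξ1 u, ξ2 u])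
    {Γ : (Fin 2 → ℝ) → Fin 2 → Fin 2 → (Fin 2 → ℝ)}
    {h1 h2 S1 S2 : (Fin 2 → ℝ) → Fin 2 → Fin 2 → ℝ}
    (hdec2 : ∀ u ∈ U, ∀ i j : Fin 2,
      pder (pder x j) i u =
        fderiv ℝ x u (Γ u i j) + h1 u i j • ξ1 u + h2 u i j • ξ2 u)
    {τ1 τ2 : (Fin 2 → ℝ) → (Fin 2 → ℝ)}
    (hdecξ1 : ∀ u ∈ U, ∀ i : Fin 2,
      pder ξ1 i u = -fderiv ℝ x u (Matrix.of (S1 u) *ᵥ Pi.single i 1)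
        + (τ1 u ⬝ᵥ Pi.single i 1) • ξ1 u)
    (hdecξ2 : ∀ u ∈ U, ∀ i : Fin 2,
      pder ξ2 i u = -fderiv ℝ x u (Matrix.of (S2 u) *ᵥ Pi.single i 1)
        + (τ2 u ⬝ᵥ Pi.single i 1) • ξ1 u)
    {p : Fin 4 → ℝ} {Z : (Fin 2 → ℝ) → (Fin 2 → ℝ)} {δ s : (Fin 2 → ℝ) → ℝ}
    (hZ : ContDiffOn ℝ (⊤ : ℕ∞) Z U) (hδ : ContDiffOn ℝ (⊤ : ℕ∞) δ U)
    (hs : ContDiffOn ℝ (⊤ : ℕ∞) s U)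
    (hdec : ∀ u ∈ U, x u - p = fderiv ℝ x u (Z u) + δ u • ξ1 u + s u • ξ2 u)
    {u : Fin 2 → ℝ} (hu : u ∈ U) (i : Fin 2) :
    pder s i u = -(h2 u i 0 * Z u 0 + h2 u i 1 * Z u 1) ∧
    ∀ k, pder (fun v => Z v k) i u + Z u 0 * Γ u i 0 k + Z u 1 * Γ u i 1 k
      - δ u * S1 u k i - s u * S2 u k i = (1 : Matrix (Fin 2) (Fin 2) ℝ) k i := by
  have diff {F : Type} [NormedAddCommGroup F] [NormedSpace ℝ F] {f : (Fin 2 → ℝ) → F}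
      (hf : ContDiffOn ℝ (⊤ : ℕ∞) f U) : DifferentiableAt ℝ f u :=
    (hf.contDiffAt (hU.mem_nhds hu)).differentiableAt (by simp)
  have dX (j : Fin 2) : DifferentiableAt ℝ (pder x j) u := diff (hx.pder hU j)
  have dZ (j : Fin 2) : DifferentiableAt ℝ (fun v => Z v j) u :=
    diff (contDiffOn_pi.1 hZ j)
  have hpos : ∀ v ∈ U, x v = Z v 0 • pder x 0 v + Z v 1 • pder x 1 v + δ v • ξ1 v
      + s v • ξ2 v + p := fun v hv => by
    rw [← fderiv_apply_eq_pder, ← hdec v hv, sub_add_cancel]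
  have hp : pder (fun _ => p) i u = 0 := by simp [pder]
  have d0 := (dZ 0).fun_smul (dX 0)
  have d1 := (dZ 1).fun_smul (dX 1)
  have d2 := (diff hδ).fun_smul (diff hξ1)
  have d3 := (diff hs).fun_smul (diff hξ2)
  have key := pder_congr hU hpos i hu
  rw [pder_add i (((d0.fun_add d1).fun_add d2).fun_add d3) (differentiableAt_const p),
    pder_add i ((d0.fun_add d1).fun_add d2) d3, pder_add i (d0.fun_add d1) d2,
    pder_add i d0 d1, pder_smul i (dZ 0) (dX 0), pder_smul i (dZ 1) (dX 1),
    pder_smul i (diff hδ) (diff hξ1), pder_smul i (diff hs) (diff hξ2), hp,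
    hdec2 u hu i 0, hdec2 u hu i 1, hdecξ1 u hu i, hdecξ2 u hu i] at key
  simp only [fderiv_apply_eq_pder, Matrix.mulVec_single_one, Matrix.col_apply,
    Matrix.of_apply] at key
  have hxi : pder x i u = (1 : Matrix (Fin 2) (Fin 2) ℝ) 0 i • pder x 0 u
      + (1 : Matrix (Fin 2) (Fin 2) ℝ) 1 i • pder x 1 u + (0 : ℝ) • ξ1 u + (0 : ℝ) • ξ2 u := by
    obtain rfl | rfl : i = 0 ∨ i = 1 := by lia
    all_goals simp
  rw [hxi] at key
  obtain ⟨e0, e1, -, e3⟩ := (hind u hu).eq_of_fin_four_combination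
    (a' := pder (fun v => Z v 0) i u + Z u 0 * Γ u i 0 0 + Z u 1 * Γ u i 1 0
      - δ u * S1 u 0 i - s u * S2 u 0 i)
    (b' := pder (fun v => Z v 1) i u + Z u 0 * Γ u i 0 1 + Z u 1 * Γ u i 1 1
      - δ u * S1 u 1 i - s u * S2 u 1 i)
    (c' := Z u 0 * h1 u i 0 + Z u 1 * h1 u i 1 + pder δ i u
      + δ u * (τ1 u ⬝ᵥ Pi.single i 1) + s u * (τ2 u ⬝ᵥ Pi.single i 1))
    (d' := pder s i u + (h2 u i 0 * Z u 0 + h2 u i 1 * Z u 1))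
    (key.trans (by module))
  refine ⟨by linarith, fun k => ?_⟩
  fin_cases k
  · exact e0.symm
  · exact e1.symm

theorem Matrix.eq_zero_of_isUnit_of_rows_fin_two {A : Fin 2 → Fin 2 → ℝ}
    (hA : IsUnit (Matrix.of A)) {v : Fin 2 → ℝ}
    (h : ∀ i, A i 0 * v 0 + A i 1 * v 1 = 0) : v = 0 := by
  refine Matrix.mulVec_injective_of_isUnit hA ?_
  ext i
  simpa [Matrix.mulVec, dotProduct, Fin.sum_univ_two] using h i

/-- If `∂_j s = -∑ k, h_{jk} Z_k` and `Z` vanishes at `u`, then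
`∂_i ∂_j s = -∑ k, h_{jk} ∂_i Z_k` at `u`. -/
theorem pder_pder_eq_of_gradient {U : Set (Fin 2 → ℝ)} (hU : IsOpen U)
    {h : (Fin 2 → ℝ) → Fin 2 → Fin 2 → ℝ} (hh : ContDiffOn ℝ (⊤ : ℕ∞) h U)
    {Z : (Fin 2 → ℝ) → (Fin 2 → ℝ)} (hZ : ContDiffOn ℝ (⊤ : ℕ∞) Z U)
    {s : (Fin 2 → ℝ) → ℝ} (j : Fin 2)
    (hs : ∀ u ∈ U, pder s j u = -(h u j 0 * Z u 0 + h u j 1 * Z u 1))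
    {u : Fin 2 → ℝ} (hu : u ∈ U) (hZu : Z u = 0) (i : Fin 2) :
    pder (pder s j) i u =
      -(h u j 0 * pder (fun v => Z v 0) i u + h u j 1 * pder (fun v => Z v 1) i u) := by
  have diff {f : (Fin 2 → ℝ) → ℝ} (hf : ContDiffOn ℝ (⊤ : ℕ∞) f U) :
      DifferentiableAt ℝ f u :=
    (hf.contDiffAt (hU.mem_nhds hu)).differentiableAt (by simp)
  have dZ (k : Fin 2) : DifferentiableAt ℝ (fun v => Z v k) u :=
    diff (contDiffOn_pi.1 hZ k)
  have dh (k : Fin 2) : DifferentiableAt ℝ (fun v => -h v j k) u :=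
    (diff (contDiffOn_pi.1 (contDiffOn_pi.1 hh j) k)).fun_neg
  have hs' : ∀ v ∈ U, pder s j v = (-h v j 0) • Z v 0 + (-h v j 1) • Z v 1 := fun v hv => by
    rw [hs v hv, smul_eq_mul, smul_eq_mul]
    ring
  rw [pder_congr hU hs' i hu, pder_add i ((dh 0).fun_smul (dZ 0)) ((dh 1).fun_smul (dZ 1)),
    pder_smul i (dh 0) (dZ 0), pder_smul i (dh 1) (dZ 1), hZu]
  simp only [smul_eq_mul, Pi.zero_apply]
  ring

/-- Affine semiumbilic points are exactly the corank-2 singularities of some affine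
distance function: under the decomposition hypotheses, with `(h2_{ij}(u0))` invertible,
there is a point `p` whose affine distance function has a critical point at `u0` with
vanishing Hessian if and only if some nontrivial combination `a S1(u0) + b S2(u0)` is a
nonzero multiple of the identity. -/
theorem stmt10 (U : Set (Fin 2 → ℝ)) (hU : IsOpen U)
    (x ξ1 ξ2 : (Fin 2 → ℝ) → (Fin 4 → ℝ))
    (hx : ContDiffOn ℝ (⊤ : ℕ∞) x U) (hξ1 : ContDiffOn ℝ (⊤ : ℕ∞) ξ1 U)
    (hξ2 : ContDiffOn ℝ (⊤ : ℕ∞) ξ2 U)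
    (hind : ∀ u ∈ U, LinearIndependent ℝ ![pder x 0 u, pder x 1 u, ξ1 u, ξ2 u])
    (Γ : (Fin 2 → ℝ) → Fin 2 → Fin 2 → (Fin 2 → ℝ))
    (h1 h2 : (Fin 2 → ℝ) → Fin 2 → Fin 2 → ℝ)
    (hΓ : ContDiffOn ℝ (⊤ : ℕ∞) Γ U)
    (hh1 : ContDiffOn ℝ (⊤ : ℕ∞) h1 U) (hh2 : ContDiffOn ℝ (⊤ : ℕ∞) h2 U)
    (hdec2 : ∀ u ∈ U, ∀ i j : Fin 2,
      pder (pder x j) i u =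
        fderiv ℝ x u (Γ u i j) + h1 u i j • ξ1 u + h2 u i j • ξ2 u)
    (S1 S2 : (Fin 2 → ℝ) → Fin 2 → Fin 2 → ℝ)
    (τ1 τ2 : (Fin 2 → ℝ) → (Fin 2 → ℝ))
    (hS1 : ContDiffOn ℝ (⊤ : ℕ∞) S1 U) (hS2 : ContDiffOn ℝ (⊤ : ℕ∞) S2 U)
    (hτ1 : ContDiffOn ℝ (⊤ : ℕ∞) τ1 U) (hτ2 : ContDiffOn ℝ (⊤ : ℕ∞) τ2 U)
    (hdecξ1 : ∀ u ∈ U, ∀ i : Fin 2,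
      pder ξ1 i u = -fderiv ℝ x u (Matrix.of (S1 u) *ᵥ Pi.single i 1)
        + (τ1 u ⬝ᵥ Pi.single i 1) • ξ1 u)
    (hdecξ2 : ∀ u ∈ U, ∀ i : Fin 2,
      pder ξ2 i u = -fderiv ℝ x u (Matrix.of (S2 u) *ᵥ Pi.single i 1)
        + (τ2 u ⬝ᵥ Pi.single i 1) • ξ1 u)
    (u0 : Fin 2 → ℝ) (hu0 : u0 ∈ U)
    (hinv : IsUnit (Matrix.of (h2 u0))) :
    (∃ (p : Fin 4 → ℝ) (Z : (Fin 2 → ℝ) → (Fin 2 → ℝ)) (δp sp : (Fin 2 → ℝ) → ℝ),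
      ContDiffOn ℝ (⊤ : ℕ∞) Z U ∧ ContDiffOn ℝ (⊤ : ℕ∞) δp U ∧
      ContDiffOn ℝ (⊤ : ℕ∞) sp U ∧
      (∀ u ∈ U, x u - p = fderiv ℝ x u (Z u) + δp u • ξ1 u + sp u • ξ2 u) ∧
      (∀ i : Fin 2, fderiv ℝ sp u0 (Pi.single i 1) = 0) ∧
      (∀ i j : Fin 2, pder (pder sp j) i u0 = 0)) ↔
    (∃ (a b μ : ℝ), (a, b) ≠ (0, 0) ∧ μ ≠ 0 ∧
      a • Matrix.of (S1 u0) + b • Matrix.of (S2 u0) =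
        μ • (1 : Matrix (Fin 2) (Fin 2) ℝ)) := by
  constructor
  · rintro ⟨p, Z, δ, s, hZ, hδ, hs, hdec, hcrit, hhess⟩
    have struct {u : Fin 2 → ℝ} (hu : u ∈ U) (i : Fin 2) :=
      position_structure_equations hU hx hξ1 hξ2 hind hdec2 hdecξ1 hdecξ2 hZ hδ hs hdec hu i
    have hZ0 : Z u0 = 0 := Matrix.eq_zero_of_isUnit_of_rows_fin_two hinv fun i => by
      have e := (struct hu0 i).1
      rw [pder, hcrit i] at e
      linarith
    have hdZ (i : Fin 2) : (fun k => pder (fun v => Z v k) i u0) = 0 :=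
      Matrix.eq_zero_of_isUnit_of_rows_fin_two hinv fun j => by
        have e := pder_pder_eq_of_gradient hU hh2 hZ j
          (fun u hu => (struct hu j).1) hu0 hZ0 i
        rw [hhess i j] at e
        linarith
    have hS (k i : Fin 2) : -δ u0 * S1 u0 k i + -s u0 * S2 u0 k i
        = (1 : Matrix (Fin 2) (Fin 2) ℝ) k i := by
      have e := (struct hu0 i).2 k
      have ez : pder (fun v => Z v k) i u0 = 0 := congrFun (hdZ i) k
      rw [ez, hZ0] at e
      simp only [Pi.zero_apply] at e
      linarith
    refine ⟨-δ u0, -s u0, 1, fun h0 => ?_, one_ne_zero, ?_⟩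
    · obtain ⟨ha, hb⟩ := Prod.mk.inj h0
      have e := hS 0 0
      rw [ha, hb] at e
      simp at e
    · ext k i
      simpa using hS k i
  · rintro ⟨a, b, μ, -, hμ, hab⟩
    obtain ⟨c, hc, hcoord⟩ := exists_contDiffOn_frame_coordinates (k := (⊤ : ℕ∞)) (s := U)
      (F := fun u => ![pder x 0 u, pder x 1 u, ξ1 u, ξ2 u])
      (y := fun u => x u - (x u0 + (a / μ) • ξ1 u0 + (b / μ) • ξ2 u0))
      (fun i => by
        fin_cases i
        · exact hx.pder hU 0
        · exact hx.pder hU 1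
        · exact hξ1
        · exact hξ2)
      (hx.sub contDiffOn_const) hind
    simp only [Fin.sum_univ_four, Matrix.cons_val] at hcoord
    have hZ : ContDiffOn ℝ (⊤ : ℕ∞) (fun u => ![c 0 u, c 1 u]) U :=
      contDiffOn_pi.2 fun k => by
        fin_cases k
        · exact hc 0
        · exact hc 1
    have hdec : ∀ u ∈ U, x u - (x u0 + (a / μ) • ξ1 u0 + (b / μ) • ξ2 u0)
        = fderiv ℝ x u ![c 0 u, c 1 u] + c 2 u • ξ1 u + c 3 u • ξ2 u := fun u hu => by
      rw [hcoord u hu, fderiv_apply_eq_pder]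
      simp
    have struct {u : Fin 2 → ℝ} (hu : u ∈ U) (i : Fin 2) :=
      position_structure_equations hU hx hξ1 hξ2 hind hdec2 hdecξ1 hdecξ2 hZ (hc 2) (hc 3)
        hdec hu i
    obtain ⟨z0, z1, z2, z3⟩ := (hind u0 hu0).eq_of_fin_four_combination
      (a' := 0) (b' := 0) (c' := -(a / μ)) (d' := -(b / μ))
      ((hcoord u0 hu0).symm.trans (by module))
    have hZ0 : ![c 0 u0, c 1 u0] = 0 := by simp [z0, z1]
    have hdZ (i k : Fin 2) : pder (fun v => ![c 0 v, c 1 v] k) i u0 = 0 := by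
      have e := (struct hu0 i).2 k
      have hki : a * S1 u0 k i + b * S2 u0 k i = μ * (1 : Matrix (Fin 2) (Fin 2) ℝ) k i := by
        simpa using congrFun (congrFun hab k) i
      rw [hZ0, z2, z3] at e
      simp only [Pi.zero_apply] at e
      have hki' : a / μ * S1 u0 k i + b / μ * S2 u0 k i
          = (1 : Matrix (Fin 2) (Fin 2) ℝ) k i := by
        rw [div_mul_eq_mul_div, div_mul_eq_mul_div, ← add_div, hki, mul_div_cancel_left₀ _ hμ]
      linarith
    refine ⟨_, fun u => ![c 0 u, c 1 u], c 2, c 3, hZ, hc 2, hc 3, hdec, fun i => ?_,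
      fun i j => ?_⟩
    · have e := (struct hu0 i).1
      rw [hZ0] at e
      simpa [pder] using e
    · rw [pder_pder_eq_of_gradient hU hh2 hZ j (fun u hu => (struct hu j).1) hu0 hZ0 i,
        hdZ i 0, hdZ i 1]
      simp
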